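/- arXiv:1511.09025 — 2 statements merged into one kernel-verified Lean document; each statement's English description precedes it below -/
import Mathlib

section
/- For all Borel probability measures P, Q on ℝ with finite second moments, the infimum of ∫ (s−t)² dπ(s,t) over all couplings π of P and Q equals ∫₀¹ (F_P⁻¹(u) − F_Q⁻¹(u))² du, where F_P⁻¹(u) = inf{ s ∈ ℝ : P((−∞,s]) > u } is the right-continuous quantile function of P. -/
open MeasureTheory ENNReal

noncomputable section

/-- `π` is a coupling of `μ` and `ν`. -/
def IsCoupling {α β : Type*} [MeasurableSpace α] [MeasurableSpace β]
    (μ : Measure α) (ν : Measure β) (π : Measure (α × β)) : Prop :=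
  π.map Prod.fst = μ ∧ π.map Prod.snd = ν

/-- The right-continuous quantile function `F_P⁻¹(u) = inf { s : P((-∞,s]) > u }`. -/
def invF (P : Measure ℝ) (u : ℝ) : ℝ := sInf {s : ℝ | u < (P (Set.Iic s)).toReal}

theorem IsCoupling.swap {α β : Type*} [MeasurableSpace α] [MeasurableSpace β]
    {μ : Measure α} {ν : Measure β} {π : Measure (α × β)} (h : IsCoupling μ ν π) :
    IsCoupling ν μ (π.map Prod.swap) := by
  refine ⟨?_, ?_⟩
  · rw [Measure.map_map measurable_fst measurable_swap]
    exact h.2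
  · rw [Measure.map_map measurable_snd measurable_swap]
    exact h.1

theorem IsCoupling.isProbabilityMeasure {α β : Type*} [MeasurableSpace α] [MeasurableSpace β]
    {μ : Measure α} {ν : Measure β} [IsProbabilityMeasure μ] {π : Measure (α × β)}
    (h : IsCoupling μ ν π) : IsProbabilityMeasure π := by
  have : IsProbabilityMeasure (π.map Prod.fst) := h.1 ▸ inferInstance
  exact Measure.isProbabilityMeasure_of_map Prod.fst

section Quantile

variable (P : Measure ℝ) [IsProbabilityMeasure P]

theorem bddBelow_setOf_lt_measure_Iic {u : ℝ} (hu : 0 < u) :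
    BddBelow {s : ℝ | u < (P (Set.Iic s)).toReal} := by
  have h : ∀ᶠ s in Filter.atBot, ProbabilityTheory.cdf P s < u :=
    (ProbabilityTheory.tendsto_cdf_atBot P).eventually_lt_const hu
  obtain ⟨a, ha⟩ := h.exists
  refine ⟨a, fun s hs => ?_⟩
  by_contra! hsa
  have h1 := ProbabilityTheory.monotone_cdf P hsa.le
  rw [ProbabilityTheory.cdf_eq_real P s] at h1
  exact absurd (lt_of_lt_of_le hs h1) ha.le.not_gt

theorem nonempty_setOf_lt_measure_Iic {u : ℝ} (hu : u < 1) :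
    {s : ℝ | u < (P (Set.Iic s)).toReal}.Nonempty := by
  have h : ∀ᶠ s in Filter.atTop, u < ProbabilityTheory.cdf P s :=
    (ProbabilityTheory.tendsto_cdf_atTop P).eventually_const_lt hu
  obtain ⟨a, ha⟩ := h.exists
  rw [ProbabilityTheory.cdf_eq_real P a] at ha
  exact ⟨a, ha⟩

theorem monotoneOn_invF : MonotoneOn (invF P) (Set.Ioo 0 1) := fun _ hu _ hv huv =>
  csInf_le_csInf (bddBelow_setOf_lt_measure_Iic P hu.1) (nonempty_setOf_lt_measure_Iic P hv.2)
    fun _ hs => lt_of_le_of_lt huv hs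

theorem aemeasurable_invF : AEMeasurable (invF P) (volume.restrict (Set.Ioo 0 1)) :=
  aemeasurable_restrict_of_monotoneOn measurableSet_Ioo (monotoneOn_invF P)

theorem invF_le_of_lt_measure_Iic {u a : ℝ} (hu : 0 < u) (h : u < (P (Set.Iic a)).toReal) :
    invF P u ≤ a :=
  csInf_le (bddBelow_setOf_lt_measure_Iic P hu) h

theorem le_measure_Iic_of_invF_le {u a : ℝ} (hu : u < 1) (h : invF P u ≤ a) :
    u ≤ (P (Set.Iic a)).toReal := by
  have hc : Filter.Tendsto (ProbabilityTheory.cdf P) (nhdsWithin a (Set.Ioi a))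
      (nhds (ProbabilityTheory.cdf P a)) :=
    ((ProbabilityTheory.cdf P).right_continuous a).mono Set.Ioi_subset_Ici_self
  have hev : ∀ᶠ s in nhdsWithin a (Set.Ioi a), u ≤ ProbabilityTheory.cdf P s := by
    filter_upwards [self_mem_nhdsWithin] with s hs
    obtain ⟨t, ht, hts⟩ := exists_lt_of_csInf_lt (nonempty_setOf_lt_measure_Iic P hu)
      (lt_of_le_of_lt h hs)
    have hmono := ProbabilityTheory.monotone_cdf P hts.le
    rw [ProbabilityTheory.cdf_eq_real P t] at hmono
    exact (lt_of_lt_of_le ht hmono).le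
  have := ge_of_tendsto hc hev
  rwa [ProbabilityTheory.cdf_eq_real P a] at this

theorem map_invF : (volume.restrict (Set.Ioo (0 : ℝ) 1)).map (invF P) = P := by
  have : IsProbabilityMeasure (volume.restrict (Set.Ioo (0 : ℝ) 1)) := ⟨by simp⟩
  have := Measure.isProbabilityMeasure_map (aemeasurable_invF P)
  refine Measure.ext_of_Iic _ _ fun a => ?_
  have hle : (P (Set.Iic a)).toReal ≤ 1 := measureReal_le_one
  rw [Measure.map_apply_of_aemeasurable (aemeasurable_invF P) measurableSet_Iic,
    Measure.restrict_apply' measurableSet_Ioo]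
  refine le_antisymm ?_ ?_
  · calc volume (invF P ⁻¹' Set.Iic a ∩ Set.Ioo 0 1)
        ≤ volume (Set.Icc 0 (P (Set.Iic a)).toReal) :=
          measure_mono fun u hu => ⟨hu.2.1.le, le_measure_Iic_of_invF_le P hu.2.2 hu.1⟩
      _ = P (Set.Iic a) := by simp
  · calc P (Set.Iic a) = volume (Set.Ioo 0 (P (Set.Iic a)).toReal) := by simp
      _ ≤ volume (invF P ⁻¹' Set.Iic a ∩ Set.Ioo 0 1) :=
          measure_mono fun u hu =>
            ⟨invF_le_of_lt_measure_Iic P hu.1 hu.2, hu.1, hu.2.trans_le hle⟩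

end Quantile

/-- The comonotone coupling, given by the pair of quantile functions on `(0,1)`. -/
def quantileCoupling (P Q : Measure ℝ) : Measure (ℝ × ℝ) :=
  (volume.restrict (Set.Ioo (0 : ℝ) 1)).map fun u => (invF P u, invF Q u)

theorem isCoupling_quantileCoupling (P Q : Measure ℝ)
    [IsProbabilityMeasure P] [IsProbabilityMeasure Q] :
    IsCoupling P Q (quantileCoupling P Q) := by
  have hm := (aemeasurable_invF P).prodMk (aemeasurable_invF Q)
  refine ⟨?_, ?_⟩
  · rw [quantileCoupling, AEMeasurable.map_map_of_aemeasurable measurable_fst.aemeasurable hm]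
    exact map_invF P
  · rw [quantileCoupling, AEMeasurable.map_map_of_aemeasurable measurable_snd.aemeasurable hm]
    exact map_invF Q

theorem map_swap_quantileCoupling (P Q : Measure ℝ)
    [IsProbabilityMeasure P] [IsProbabilityMeasure Q] :
    (quantileCoupling P Q).map Prod.swap = quantileCoupling Q P := by
  have hm := (aemeasurable_invF P).prodMk (aemeasurable_invF Q)
  rw [quantileCoupling, AEMeasurable.map_map_of_aemeasurable measurable_swap.aemeasurable hm]
  rfl

/-- The comonotone coupling gives the least mass to every upper-left quadrant. -/
theorem quantileCoupling_quadrant_le (P Q : Measure ℝ)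
    [IsProbabilityMeasure P] [IsProbabilityMeasure Q] {π : Measure (ℝ × ℝ)}
    (hπ : IsCoupling P Q π) (a b : ℝ) :
    quantileCoupling P Q {p | p.1 ≤ a ∧ b < p.2} ≤ π {p | p.1 ≤ a ∧ b < p.2} := by
  have hm := (aemeasurable_invF P).prodMk (aemeasurable_invF Q)
  have hs : MeasurableSet {p : ℝ × ℝ | p.1 ≤ a ∧ b < p.2} :=
    (measurableSet_le measurable_fst measurable_const).inter
      (measurableSet_lt measurable_const measurable_snd)
  have hPa : P (Set.Iic a) = π (Prod.fst ⁻¹' Set.Iic a) := by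
    rw [← hπ.1, Measure.map_apply measurable_fst measurableSet_Iic]
  have hQb : Q (Set.Iic b) = π (Prod.snd ⁻¹' Set.Iic b) := by
    rw [← hπ.2, Measure.map_apply measurable_snd measurableSet_Iic]
  rw [quantileCoupling, Measure.map_apply_of_aemeasurable hm hs,
    Measure.restrict_apply' measurableSet_Ioo]
  calc _ ≤ volume (Set.Icc (Q (Set.Iic b)).toReal (P (Set.Iic a)).toReal) := by
        refine measure_mono fun u hu => ⟨?_, le_measure_Iic_of_invF_le P hu.2.2 hu.1.1⟩
        by_contra! hlt
        exact (invF_le_of_lt_measure_Iic Q hu.2.1 hlt).not_gt hu.1.2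
    _ = P (Set.Iic a) - Q (Set.Iic b) := by
        rw [Real.volume_Icc, ENNReal.ofReal_sub _ ENNReal.toReal_nonneg,
          ENNReal.ofReal_toReal (measure_ne_top _ _), ENNReal.ofReal_toReal (measure_ne_top _ _)]
    _ ≤ π (Prod.fst ⁻¹' Set.Iic a \ Prod.snd ⁻¹' Set.Iic b) := by
        rw [hPa, hQb]
        exact le_measure_sdiff
    _ ≤ π {p | p.1 ≤ a ∧ b < p.2} := measure_mono fun p hp => ⟨hp.1, not_le.mp hp.2⟩

theorem lintegral_ofReal_sub_sq_eq (π : Measure (ℝ × ℝ)) [SFinite π] :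
    ∫⁻ p, ENNReal.ofReal (p.2 - p.1) ^ 2 ∂π =
      ∫⁻ z : ℝ × ℝ, π {p | p.1 ≤ min z.1 z.2 ∧ max z.1 z.2 < p.2} := by
  let D : Set ((ℝ × ℝ) × (ℝ × ℝ)) :=
    {x | x.1.1 ≤ min x.2.1 x.2.2 ∧ max x.2.1 x.2.2 < x.1.2}
  have hD : MeasurableSet D :=
    (measurableSet_le (f := fun x : (ℝ × ℝ) × (ℝ × ℝ) => x.1.1)
      (g := fun x => min x.2.1 x.2.2) (by fun_prop) (by fun_prop)).inter
      (measurableSet_lt (f := fun x : (ℝ × ℝ) × (ℝ × ℝ) => max x.2.1 x.2.2)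
        (g := fun x => x.1.2) (by fun_prop) (by fun_prop))
  have hsection (p : ℝ × ℝ) :
      (volume : Measure (ℝ × ℝ)) (Prod.mk p ⁻¹' D) = ENNReal.ofReal (p.2 - p.1) ^ 2 := by
    have : Prod.mk p ⁻¹' D = Set.Ico p.1 p.2 ×ˢ Set.Ico p.1 p.2 := by
      ext z
      simp only [D, Set.mem_preimage, Set.mem_ofPred_eq, le_min_iff, max_lt_iff, Set.mem_prod,
        Set.mem_Ico]
      tauto
    rw [this, Measure.volume_eq_prod, Measure.prod_prod, Real.volume_Ico, sq]
  calc _ = ∫⁻ p, (volume : Measure (ℝ × ℝ)) (Prod.mk p ⁻¹' D) ∂π := by simp_rw [hsection]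
    _ = (π.prod volume) D := (Measure.prod_apply hD).symm
    _ = _ := Measure.prod_apply_symm hD

theorem lintegral_quantileCoupling_ofReal_sub_sq_le (P Q : Measure ℝ)
    [IsProbabilityMeasure P] [IsProbabilityMeasure Q] {π : Measure (ℝ × ℝ)}
    (hπ : IsCoupling P Q π) :
    ∫⁻ p, ENNReal.ofReal (p.2 - p.1) ^ 2 ∂(quantileCoupling P Q) ≤
      ∫⁻ p, ENNReal.ofReal (p.2 - p.1) ^ 2 ∂π := by
  have := hπ.isProbabilityMeasure
  have := (isCoupling_quantileCoupling P Q).isProbabilityMeasure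
  rw [lintegral_ofReal_sub_sq_eq, lintegral_ofReal_sub_sq_eq]
  exact lintegral_mono fun z => quantileCoupling_quadrant_le P Q hπ _ _

theorem lintegral_ofReal_sq_sub (π : Measure (ℝ × ℝ)) :
    ∫⁻ p, ENNReal.ofReal ((p.1 - p.2) ^ 2) ∂π =
      ∫⁻ p, ENNReal.ofReal (p.2 - p.1) ^ 2 ∂π +
        ∫⁻ p, ENNReal.ofReal (p.2 - p.1) ^ 2 ∂(π.map Prod.swap) := by
  rw [lintegral_map (by fun_prop) measurable_swap, ← lintegral_add_left (by fun_prop)]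
  refine lintegral_congr fun p => ?_
  simp only [Prod.fst_swap, Prod.snd_swap]
  rcases le_total p.1 p.2 with h | h
  · rw [ENNReal.ofReal_of_nonpos (sub_nonpos.mpr h), ← ENNReal.ofReal_pow (sub_nonneg.mpr h),
      ← neg_sub p.2 p.1, neg_sq]
    simp
  · rw [ENNReal.ofReal_of_nonpos (sub_nonpos.mpr h), ← ENNReal.ofReal_pow (sub_nonneg.mpr h)]
    simp

/-- One-dimensional optimal transportation: the squared quadratic Kantorovich distance equals
the `L²`-distance of the quantile functions on `(0,1)`. -/
theorem W2sq_eq_quantile_distance (P Q : Measure ℝ)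
    [IsProbabilityMeasure P] [IsProbabilityMeasure Q]
    (hP : Integrable (fun s => s ^ 2) P) (hQ : Integrable (fun s => s ^ 2) Q) :
    (⨅ (π : Measure (ℝ × ℝ)) (_ : IsCoupling P Q π),
        ∫⁻ p, ENNReal.ofReal ((p.1 - p.2) ^ 2) ∂π) =
      ∫⁻ u in Set.Ioo (0 : ℝ) 1, ENNReal.ofReal ((invF P u - invF Q u) ^ 2) := by
  have hm := (aemeasurable_invF P).prodMk (aemeasurable_invF Q)
  have hcost : ∫⁻ p, ENNReal.ofReal ((p.1 - p.2) ^ 2) ∂(quantileCoupling P Q) =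
      ∫⁻ u in Set.Ioo (0 : ℝ) 1, ENNReal.ofReal ((invF P u - invF Q u) ^ 2) :=
    lintegral_map' (by fun_prop) hm
  rw [← hcost]
  refine le_antisymm (iInf₂_le _ (isCoupling_quantileCoupling P Q)) (le_iInf₂ fun π hπ => ?_)
  rw [lintegral_ofReal_sq_sub, lintegral_ofReal_sq_sub π, map_swap_quantileCoupling]
  exact add_le_add (lintegral_quantileCoupling_ofReal_sub_sq_le P Q hπ)
    (lintegral_quantileCoupling_ofReal_sub_sq_le Q P hπ.swap)
end
end

section
/- Let Φ : ℝⁿ → ℝ be a convex differentiable function and L > 0. Then ∇Φ is L-Lipschitz, i.e. ‖∇Φ(a) − ∇Φ(b)‖ ≤ L‖a − b‖ for all a, b ∈ ℝⁿ, if and only if Φ(a) − Φ(b) − ⟨∇Φ(b), a − b⟩ ≤ (L/2)‖a − b‖² for all a, b ∈ ℝⁿ. -/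
open MeasureTheory
open scoped RealInnerProductSpace

noncomputable section

section BregmanBound

variable {E : Type*} [NormedAddCommGroup E] [InnerProductSpace ℝ E] [CompleteSpace E] {Φ : E → ℝ}

lemma hasDerivAt_comp_line_of_differentiable (hdiff : Differentiable ℝ Φ) (b v : E) (t : ℝ) :
    HasDerivAt (fun s : ℝ => Φ (b + s • v)) ⟪gradient Φ (b + t • v), v⟫ t := by
  have hline : HasDerivAt (fun s : ℝ => b + s • v) v t := by
    simpa using ((hasDerivAt_id t).smul_const v).const_add b
  have h := (hdiff (b + t • v)).hasGradientAt.hasFDerivAt.comp_hasDerivAt t hline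
  simpa [Function.comp_def] using h

lemma ConvexOn.add_inner_gradient_le (hconv : ConvexOn ℝ Set.univ Φ) (hdiff : Differentiable ℝ Φ)
    (a b : E) : Φ b + ⟪gradient Φ b, a - b⟫ ≤ Φ a := by
  have hline : ConvexOn ℝ Set.univ (fun s : ℝ => Φ (b + s • (a - b))) := by
    have h := hconv.comp_affineMap (AffineMap.lineMap b a : ℝ →ᵃ[ℝ] E)
    simpa [Function.comp_def, AffineMap.lineMap_apply, add_comm] using h
  have hderiv := hasDerivAt_comp_line_of_differentiable hdiff b (a - b) 0
  have h := hline.le_slope_of_hasDerivAt (Set.mem_univ 0) (Set.mem_univ 1) zero_lt_one hderiv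
  simp only [slope_def_field, zero_smul, one_smul, add_zero, add_sub_cancel, sub_zero, div_one] at h
  linarith

lemma bregman_le_of_lipschitz_gradient (hdiff : Differentiable ℝ Φ) {L : ℝ}
    (hlip : ∀ a b, ‖gradient Φ a - gradient Φ b‖ ≤ L * ‖a - b‖) (a b : E) :
    Φ a - Φ b - ⟪gradient Φ b, a - b⟫ ≤ (L / 2) * ‖a - b‖ ^ 2 := by
  set v := a - b with hv
  have hderiv (t : ℝ) : HasDerivAt
      (fun s : ℝ => Φ (b + s • v) - s * ⟪gradient Φ b, v⟫ - s ^ 2 * ((L / 2) * ‖v‖ ^ 2))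
      (⟪gradient Φ (b + t • v), v⟫ - ⟪gradient Φ b, v⟫ - 2 * t * ((L / 2) * ‖v‖ ^ 2)) t := by
    have h := ((hasDerivAt_comp_line_of_differentiable hdiff b v t).sub
      ((hasDerivAt_id t).mul_const ⟪gradient Φ b, v⟫)).sub
      ((hasDerivAt_pow 2 t).mul_const ((L / 2) * ‖v‖ ^ 2))
    exact h.congr_deriv (by simp only [one_mul]; norm_num)
  have hanti : AntitoneOn
      (fun s : ℝ => Φ (b + s • v) - s * ⟪gradient Φ b, v⟫ - s ^ 2 * ((L / 2) * ‖v‖ ^ 2))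
      (Set.Icc 0 1) := by
    refine antitoneOn_of_deriv_nonpos (convex_Icc 0 1)
      (fun t _ => (hderiv t).continuousAt.continuousWithinAt)
      (fun t _ => (hderiv t).differentiableAt.differentiableWithinAt) fun t ht => ?_
    rw [interior_Icc] at ht
    rw [(hderiv t).deriv, ← inner_sub_left]
    have hinner := real_inner_le_norm (gradient Φ (b + t • v) - gradient Φ b) v
    have hnorm := hlip (b + t • v) b
    rw [add_sub_cancel_left, norm_smul, Real.norm_of_nonneg ht.1.le] at hnorm
    nlinarith [mul_le_mul_of_nonneg_right hnorm (norm_nonneg v)]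
  have h := hanti (Set.left_mem_Icc.2 zero_le_one) (Set.right_mem_Icc.2 zero_le_one) zero_le_one
  simp only [zero_smul, one_smul, add_zero, hv, add_sub_cancel] at h
  linarith

lemma norm_gradient_sub_le_of_bregman_le (hconv : ConvexOn ℝ Set.univ Φ)
    (hdiff : Differentiable ℝ Φ) {L : ℝ} (hL : 0 < L)
    (hbreg : ∀ a b, Φ a - Φ b - ⟪gradient Φ b, a - b⟫ ≤ (L / 2) * ‖a - b‖ ^ 2) (a b : E) :
    ‖gradient Φ a - gradient Φ b‖ ≤ L * ‖a - b‖ := by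
  set d := gradient Φ a - gradient Φ b with hd
  set w := -(L⁻¹ • d) with hw
  have hlower := hconv.add_inner_gradient_le hdiff (a + w) b
  have hupper := hbreg (a + w) a
  have hab := hbreg a b
  rw [add_sub_right_comm, inner_add_right] at hlower
  rw [add_sub_cancel_left] at hupper
  have hinner : ⟪gradient Φ a, w⟫ - ⟪gradient Φ b, w⟫ = -(L⁻¹ * ‖d‖ ^ 2) := by
    rw [← inner_sub_left, ← hd, hw, inner_neg_right, real_inner_smul_right,
      real_inner_self_eq_norm_sq]
  have hnorm : (L / 2) * ‖w‖ ^ 2 = L⁻¹ * ‖d‖ ^ 2 / 2 := by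
    rw [hw, norm_neg, norm_smul, Real.norm_of_nonneg (inv_nonneg.2 hL.le)]
    field_simp
  have hle : L⁻¹ * ‖d‖ ^ 2 ≤ L * ‖a - b‖ ^ 2 := by linarith
  rw [inv_mul_le_iff₀ hL] at hle
  refine (sq_le_sq₀ (norm_nonneg d) (by positivity)).1 ?_
  linarith [mul_pow L ‖a - b‖ 2]

end BregmanBound

/-- For a convex differentiable function on `ℝⁿ`, the gradient is `L`-Lipschitz if and only if
the Bregman divergence is bounded by `(L/2)‖a - b‖²`. -/
theorem lipschitz_gradient_iff_bregman_bound {n : ℕ} (Φ : EuclideanSpace ℝ (Fin n) → ℝ)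
    (hconv : ConvexOn ℝ Set.univ Φ) (hdiff : Differentiable ℝ Φ) (L : ℝ) (hL : 0 < L) :
    (∀ a b : EuclideanSpace ℝ (Fin n), ‖gradient Φ a - gradient Φ b‖ ≤ L * ‖a - b‖) ↔
      (∀ a b : EuclideanSpace ℝ (Fin n),
        Φ a - Φ b - ⟪gradient Φ b, a - b⟫ ≤ (L / 2) * ‖a - b‖ ^ 2) := by
  exact ⟨bregman_le_of_lipschitz_gradient hdiff,
    norm_gradient_sub_le_of_bregman_le hconv hdiff hL⟩
end
end
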